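/- Let p, q ≥ 1 and k, m ≥ 1 with k ≥ 2 or m ≥ 2. If f ∈ C^p(A, A^(⊗k)) and g ∈ C^q(A, A^(⊗m)) are Hochschild cocycles (bf = 0 and bg = 0), then the cup product f∪g ∈ C^(p+q)(A, A^(⊗(k+m−1))) is a Hochschild coboundary; in other words, the cup product induces the zero map H^p(A, A^(⊗k)) × H^q(A, A^(⊗m)) → H^(p+q)(A, A^(⊗(k+m−1))) whenever k ≥ 2 or m ≥ 2. -/

import Mathlib

open scoped TensorProduct

noncomputable section

/-- Tuple obtained by concatenating `x` and `y` while multiplying the two adjacent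
boundary components: `(x₀,…,x_{a-1}, x_a·y₀, y₁,…,y_b)`. -/
def mergeTuple {A : Type} [Mul A] {a b : ℕ} (x : Fin (a + 1) → A) (y : Fin (b + 1) → A) :
    Fin (a + b + 1) → A :=
  fun i =>
    if h : i.1 < a then x ⟨i.1, by omega⟩
    else if h' : i.1 = a then x (Fin.last a) * y 0
    else y ⟨i.1 - a, by have := i.2; omega⟩

/-- Plain concatenation of tuples. -/
def appendTuple {A : Type} {a b : ℕ} (x : Fin (a + 1) → A) (y : Fin (b + 1) → A) :
    Fin (a + b + 2) → A :=
  fun i =>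
    if h : i.1 ≤ a then x ⟨i.1, by omega⟩
    else y ⟨i.1 - (a + 1), by have := i.2; omega⟩

/-- The tuple `(a₁,…,aᵢ·a_{i+1},…,a_{n+2})` (0-indexed: multiply entries `i` and `i+1`). -/
def mulArg {A : Type} [Mul A] {n : ℕ} (a : Fin (n + 2) → A) (i : Fin (n + 1)) :
    Fin (n + 1) → A :=
  fun j =>
    if j.1 < i.1 then a ⟨j.1, by have := j.2; omega⟩
    else if j.1 = i.1 then a ⟨j.1, by have := j.2; omega⟩ * a ⟨j.1 + 1, by have := j.2; omega⟩
    else a ⟨j.1 + 1, by have := j.2; omega⟩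

/-- The tower `⊕_{m ≥ 1} A^{⊗m}` of tensor powers of `A` (that is, the positive part of
the free product `A_t = A ∗ k[t]`, via `A^{⊗m} ∋ a₁⊗⋯⊗a_m ↔ a₁ t a₂ t ⋯ t a_m`),
together with:
* pure tensors `τ` and a `model` identification of the degree-`(m+1)` part with
  `A^{⊗(m+1)}`, pinning the object down;
* the concatenation product `conc` and the merge product
  `mrg((x₁⊗⋯⊗x_a), (y₁⊗⋯⊗y_b)) = x₁⊗⋯⊗(x_a·y₁)⊗⋯⊗y_b`;
* insertion operators `headIns`/`tailIns` extending a multilinear map `f` to an operator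
  `f^{[i,j]}` consuming the first (resp. last) tensor component together with given
  explicit arguments;
* the operations `⊢`, `⊣`, `∪` on Hochschild cochains `C^p(A, A^{⊗q})` (a cochain being
  a multilinear map `A^p → ⊕_m A^{⊗m}`, with values in a fixed degree), and the
  Hochschild differential `hoch`, all characterized by their defining formulas. -/
structure TensorTower (k : Type) [Field k] (A : Type) [Ring A] [Algebra k A] : Type 1 where
  U : Type
  [acg : AddCommGroup U]
  [mod : Module k U]
  Tdeg : ℕ → Submodule k U
  grading : DirectSum.IsInternal Tdeg
  Tdeg_zero : Tdeg 0 = ⊥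
  τ : ∀ m : ℕ, MultilinearMap k (fun _ : Fin (m + 1) => A) U
  τ_mem : ∀ (m : ℕ) (x : Fin (m + 1) → A), τ m x ∈ Tdeg (m + 1)
  model : ∀ m : ℕ, (TensorPower k (m + 1) A) ≃ₗ[k] (Tdeg (m + 1))
  model_eq : ∀ (m : ℕ) (x : Fin (m + 1) → A),
    ((model m (PiTensorProduct.tprod k x)) : U) = τ m x
  conc : U →ₗ[k] U →ₗ[k] U
  conc_eq : ∀ {a b : ℕ} (x : Fin (a + 1) → A) (y : Fin (b + 1) → A),
    conc (τ a x) (τ b y) = τ (a + b + 1) (appendTuple x y)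
  mrg : U →ₗ[k] U →ₗ[k] U
  mrg_eq : ∀ {a b : ℕ} (x : Fin (a + 1) → A) (y : Fin (b + 1) → A),
    mrg (τ a x) (τ b y) = τ (a + b) (mergeTuple x y)
  headIns : ∀ {p : ℕ},
    (MultilinearMap k (fun _ : Fin (p + 1) => A) U) → (Fin p → A) → (U →ₗ[k] U)
  headIns_eq : ∀ {p : ℕ} (f : MultilinearMap k (fun _ : Fin (p + 1) => A) U)
      (v : Fin p → A) {N : ℕ} (x : Fin (N + 2) → A),
    headIns f v (τ (N + 1) x) = conc (f (Fin.snoc v (x 0))) (τ N (Fin.tail x))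
  headIns_eq_one : ∀ {p : ℕ} (f : MultilinearMap k (fun _ : Fin (p + 1) => A) U)
      (v : Fin p → A) (x : Fin 1 → A),
    headIns f v (τ 0 x) = f (Fin.snoc v (x 0))
  tailIns : ∀ {q : ℕ},
    (MultilinearMap k (fun _ : Fin (q + 1) => A) U) → (Fin q → A) → (U →ₗ[k] U)
  tailIns_eq : ∀ {q : ℕ} (g : MultilinearMap k (fun _ : Fin (q + 1) => A) U)
      (v : Fin q → A) {N : ℕ} (x : Fin (N + 2) → A),
    tailIns g v (τ (N + 1) x)
      = conc (τ N (Fin.init x)) (g (Fin.cons (x (Fin.last (N + 1))) v))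
  tailIns_eq_one : ∀ {q : ℕ} (g : MultilinearMap k (fun _ : Fin (q + 1) => A) U)
      (v : Fin q → A) (x : Fin 1 → A),
    tailIns g v (τ 0 x) = g (Fin.cons (x 0) v)
  vdash : ∀ {p q : ℕ},
    MultilinearMap k (fun _ : Fin (p + 2) => A) U →
    MultilinearMap k (fun _ : Fin (q + 2) => A) U →
    MultilinearMap k (fun _ : Fin (p + q + 3) => A) U
  vdash_eq : ∀ {p q : ℕ} (f : MultilinearMap k (fun _ : Fin (p + 2) => A) U)
      (g : MultilinearMap k (fun _ : Fin (q + 2) => A) U) (a : Fin (p + q + 3) → A),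
    vdash f g a
      = headIns f (fun i : Fin (p + 1) => a ⟨i.1, by have := i.2; omega⟩)
          (g (fun j : Fin (q + 2) => a ⟨p + 1 + j.1, by have := j.2; omega⟩))
  dashv : ∀ {p q : ℕ},
    MultilinearMap k (fun _ : Fin (p + 2) => A) U →
    MultilinearMap k (fun _ : Fin (q + 2) => A) U →
    MultilinearMap k (fun _ : Fin (p + q + 3) => A) U
  dashv_eq : ∀ {p q : ℕ} (f : MultilinearMap k (fun _ : Fin (p + 2) => A) U)
      (g : MultilinearMap k (fun _ : Fin (q + 2) => A) U) (a : Fin (p + q + 3) → A),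
    dashv f g a
      = tailIns g (fun j : Fin (q + 1) => a ⟨p + 2 + j.1, by have := j.2; omega⟩)
          (f (fun i : Fin (p + 2) => a ⟨i.1, by have := i.2; omega⟩))
  cup : ∀ {p q : ℕ},
    MultilinearMap k (fun _ : Fin (p + 1) => A) U →
    MultilinearMap k (fun _ : Fin (q + 1) => A) U →
    MultilinearMap k (fun _ : Fin (p + q + 2) => A) U
  cup_eq : ∀ {p q : ℕ} (f : MultilinearMap k (fun _ : Fin (p + 1) => A) U)
      (g : MultilinearMap k (fun _ : Fin (q + 1) => A) U) (a : Fin (p + q + 2) → A),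
    cup f g a
      = mrg (f (fun i : Fin (p + 1) => a ⟨i.1, by have := i.2; omega⟩))
          (g (fun j : Fin (q + 1) => a ⟨p + 1 + j.1, by have := j.2; omega⟩))
  hoch : ∀ {n : ℕ},
    MultilinearMap k (fun _ : Fin (n + 1) => A) U →
    MultilinearMap k (fun _ : Fin (n + 2) => A) U
  hoch_eq : ∀ {n : ℕ} (f : MultilinearMap k (fun _ : Fin (n + 1) => A) U)
      (a : Fin (n + 2) → A),
    hoch f a
      = mrg (τ 0 (fun _ => a 0)) (f (Fin.tail a))
        + (∑ i : Fin (n + 1), ((-1 : ℤ) ^ (i.1 + 1)) • f (mulArg a i))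
        + ((-1 : ℤ) ^ (n + 2)) • mrg (f (Fin.init a)) (τ 0 (fun _ => a (Fin.last (n + 1))))

attribute [instance] TensorTower.acg TensorTower.mod

namespace TensorTower

variable {k A : Type} [Field k] [Ring A] [Algebra k A] (T : TensorTower k A)

/-- The operation `f ∨ g = (f ⊢ g) − (f ⊣ g)` on Hochschild cochains. -/
def vee {p q : ℕ} (f : MultilinearMap k (fun _ : Fin (p + 2) => A) T.U)
    (g : MultilinearMap k (fun _ : Fin (q + 2) => A) T.U) :
    MultilinearMap k (fun _ : Fin (p + q + 3) => A) T.U :=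
  T.vdash f g - T.dashv f g

end TensorTower

section Tuples

variable {A : Type}

/-- The first `m` entries of a tuple. -/
def firstEntries {n : ℕ} (m : ℕ) (h : m ≤ n) (a : Fin n → A) : Fin m → A :=
  fun i => a ⟨i, by omega⟩

/-- The `m` entries of a tuple that follow the first `s` ones. -/
def entriesFrom {n : ℕ} (s m : ℕ) (h : s + m ≤ n) (a : Fin n → A) : Fin m → A :=
  fun i => a ⟨s + i, by omega⟩

/-- The tuple with the entries `i` and `i + 1` multiplied, for an arbitrary natural number `i`. -/
def contract [Mul A] {n : ℕ} (a : Fin (n + 1) → A) (i : ℕ) : Fin n → A :=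
  fun j => if j.1 < i then a j.castSucc
    else if j.1 = i then a j.castSucc * a j.succ else a j.succ

theorem contract_snoc [Mul A] {n i : ℕ} (v : Fin (n + 1) → A) (x : A) (h : i < n) :
    contract (Fin.snoc v x : Fin (n + 2) → A) i = Fin.snoc (contract v i) x := by
  ext j
  induction j using Fin.lastCases with
  | last => simp [contract, h.not_gt, h.ne']
  | cast j => simp [contract, ← Fin.castSucc_succ]

theorem contract_snoc_last [Mul A] {n : ℕ} (v : Fin (n + 1) → A) (x : A) :
    contract (Fin.snoc v x : Fin (n + 2) → A) n
      = Fin.snoc (Fin.init v) (v (Fin.last n) * x) := by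
  ext j
  induction j using Fin.lastCases with
  | last => simp [contract]
  | cast j => simp [contract, Fin.init]

theorem contract_cons_succ [Mul A] {n : ℕ} (v : Fin (n + 1) → A) (x : A) (i : ℕ) :
    contract (Fin.cons x v : Fin (n + 2) → A) (i + 1) = Fin.cons x (contract v i) := by
  ext j
  induction j using Fin.cases with
  | zero => simp [contract]
  | succ j => simp [contract, Fin.castSucc_succ]

theorem contract_cons_zero [Mul A] {n : ℕ} (v : Fin (n + 1) → A) (x : A) :
    contract (Fin.cons x v : Fin (n + 2) → A) 0 = Fin.cons (x * v 0) (Fin.tail v) := by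
  ext j
  induction j using Fin.cases with
  | zero => simp [contract]
  | succ j => simp [contract, Fin.tail]

theorem tail_snoc {n : ℕ} (v : Fin (n + 1) → A) (x : A) :
    Fin.tail (Fin.snoc v x : Fin (n + 2) → A) = Fin.snoc (Fin.tail v) x := by
  ext j
  induction j using Fin.lastCases with
  | last => simp [Fin.tail]
  | cast j => simp [Fin.tail, ← Fin.castSucc_succ]

theorem init_cons {n : ℕ} (v : Fin (n + 1) → A) (x : A) :
    Fin.init (Fin.cons x v : Fin (n + 2) → A) = Fin.cons x (Fin.init v) := by
  ext j
  induction j using Fin.cases with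
  | zero => simp [Fin.init]
  | succ j => simp [Fin.init, Fin.castSucc_succ]

theorem firstEntries_contract [Mul A] {n m : ℕ} (h : m ≤ n) (a : Fin (n + 1) → A) (i : ℕ) :
    firstEntries m h (contract a i) = contract (firstEntries (m + 1) (by omega) a) i :=
  rfl

theorem firstEntries_contract_of_le [Mul A] {n m i : ℕ} (h : m ≤ n) (a : Fin (n + 1) → A)
    (hi : m ≤ i) : firstEntries m h (contract a i) = firstEntries m (by omega) a :=
  funext fun j => if_pos (show j.1 < i by omega)

theorem entriesFrom_contract [Mul A] {n s m : ℕ} (h : s + m ≤ n) (a : Fin (n + 1) → A) (i : ℕ) :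
    entriesFrom s m h (contract a (s + i))
      = contract (entriesFrom s (m + 1) (by omega) a) i := by
  ext j
  simp only [entriesFrom, contract, Nat.add_lt_add_iff_left, Nat.add_left_cancel_iff]
  rfl

theorem entriesFrom_contract_of_lt [Mul A] {n s m i : ℕ} (h : s + m ≤ n) (a : Fin (n + 1) → A)
    (h' : s + 1 + m ≤ n + 1) (hi : i < s) :
    entriesFrom s m h (contract a i) = entriesFrom (s + 1) m h' a := by
  ext j
  simp only [entriesFrom, contract]
  rw [if_neg (by omega), if_neg (by omega)]
  exact congrArg a (Fin.ext (Nat.add_right_comm s j 1))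

theorem firstEntries_tail {n m : ℕ} (h : m ≤ n) (a : Fin (n + 1) → A) :
    firstEntries m h (Fin.tail a) = Fin.tail (firstEntries (m + 1) (by omega) a) :=
  rfl

theorem entriesFrom_tail {n s m : ℕ} (h : s + m ≤ n) (a : Fin (n + 1) → A) :
    entriesFrom s m h (Fin.tail a) = entriesFrom (s + 1) m (by omega) a :=
  funext fun j => congrArg a (Fin.ext (Nat.add_right_comm s j 1))

theorem tail_entriesFrom {n s m : ℕ} (h : s + (m + 1) ≤ n) (a : Fin n → A) :
    Fin.tail (entriesFrom s (m + 1) h a) = entriesFrom (s + 1) m (by omega) a :=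
  funext fun j => congrArg a (Fin.ext (Nat.add_right_comm s j 1))

end Tuples

section Multilinear

variable {k A M N P : Type} [Field k] [Ring A] [Algebra k A]
  [AddCommGroup M] [Module k M] [AddCommGroup N] [Module k N] [AddCommGroup P] [Module k P]

/-- The multilinear map `a ↦ B (f (a₁,…,a_p)) (g (a_{p+1},…,a_{p+q}))`. -/
def splitArgs {n p q : ℕ} (h : p + q = n) (B : M →ₗ[k] N →ₗ[k] P)
    (f : MultilinearMap k (fun _ : Fin p => A) M) (g : MultilinearMap k (fun _ : Fin q => A) N) :
    MultilinearMap k (fun _ : Fin n => A) P :=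
  (TensorProduct.lift B).compMultilinearMap
    ((f.domCoprod g).domDomCongr (finSumFinEquiv.trans (finCongr h)))

theorem splitArgs_apply {n p q : ℕ} (h : p + q = n) (B : M →ₗ[k] N →ₗ[k] P)
    (f : MultilinearMap k (fun _ : Fin p => A) M) (g : MultilinearMap k (fun _ : Fin q => A) N)
    (a : Fin n → A) :
    splitArgs h B f g a
      = B (f (firstEntries p (by omega) a)) (g (entriesFrom p q (by omega) a)) :=
  rfl

end Multilinear

namespace TensorTower

variable {k A : Type} [Field k] [Ring A] [Algebra k A] (T : TensorTower k A)

/-- An element of `A` as an element of degree one of the tower. -/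
def ι (x : A) : T.U := T.τ 0 (fun _ => x)

theorem τ_congr {m n : ℕ} (h : m = n) {x : Fin (m + 1) → A} {y : Fin (n + 1) → A}
    (hxy : ∀ i : Fin (m + 1), x i = y ⟨i, by omega⟩) : T.τ m x = T.τ n y := by
  subst h
  exact congrArg _ (funext hxy)

theorem Tdeg_succ (m : ℕ) : T.Tdeg (m + 1) = Submodule.span k (Set.range (T.τ m)) := by
  have h : T.Tdeg (m + 1)
      = LinearMap.range ((T.Tdeg (m + 1)).subtype ∘ₗ (T.model m).toLinearMap) := by
    rw [LinearMap.range_comp, LinearEquiv.range, Submodule.map_subtype_top]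
  rw [h, LinearMap.range_eq_map, ← PiTensorProduct.span_tprod_eq_top, Submodule.map_span,
    ← Set.range_comp]
  congr 2
  funext x
  exact T.model_eq m x

theorem span_τ : Submodule.span k (⋃ m, Set.range (T.τ m)) = ⊤ := by
  rw [eq_top_iff, ← T.grading.submodule_iSup_eq_top, iSup_le_iff]
  rintro (_ | m)
  · simp [T.Tdeg_zero]
  · rw [Tdeg_succ]
    exact Submodule.span_mono (Set.subset_iUnion_of_subset m subset_rfl)

theorem τ_induction {P : T.U → Prop} (τ : ∀ m x, P (T.τ m x))
    (add : ∀ u v, P u → P v → P (u + v)) (smul : ∀ (c : k) u, P u → P (c • u)) (u : T.U) :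
    P u := by
  have hu : u ∈ Submodule.span k (⋃ m, Set.range (T.τ m)) := T.span_τ ▸ Submodule.mem_top
  induction hu using Submodule.span_induction with
  | mem u h => obtain ⟨m, x, rfl⟩ := Set.mem_iUnion.1 h; exact τ m x
  | zero => simpa using smul 0 _ (τ 0 0)
  | add u v _ _ hu hv => exact add u v hu hv
  | smul c u _ hu => exact smul c u hu

theorem mrg_conc (x y z : T.U) : T.mrg x (T.conc y z) = T.conc (T.mrg x y) z := by
  induction x using T.τ_induction with
  | add u v hu hv => simp [hu, hv]
  | smul c u hu => simp [hu]
  | τ a x =>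
  induction y using T.τ_induction with
  | add u v hu hv => simp [hu, hv]
  | smul c u hu => simp [hu]
  | τ b y =>
  induction z using T.τ_induction with
  | add u v hu hv => simp [hu, hv]
  | smul c u hu => simp [hu]
  | τ c z =>
  simp only [T.mrg_eq, T.conc_eq]
  refine T.τ_congr (by omega) fun i => ?_
  simp only [mergeTuple, appendTuple]
  grind

theorem mrg_conc_left (x y z : T.U) : T.mrg (T.conc x y) z = T.conc x (T.mrg y z) := by
  induction x using T.τ_induction with
  | add u v hu hv => simp [hu, hv]
  | smul c u hu => simp [hu]
  | τ a x =>
  induction y using T.τ_induction with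
  | add u v hu hv => simp [hu, hv]
  | smul c u hu => simp [hu]
  | τ b y =>
  induction z using T.τ_induction with
  | add u v hu hv => simp [hu, hv]
  | smul c u hu => simp [hu]
  | τ c z =>
  simp only [T.mrg_eq, T.conc_eq]
  refine T.τ_congr (by omega) fun i => ?_
  simp only [mergeTuple, appendTuple]
  grind

theorem mrg_ι (x y : A) : T.mrg (T.ι x) (T.ι y) = T.ι (x * y) := by
  rw [ι, ι, T.mrg_eq]
  exact T.τ_congr rfl fun i => by simp [mergeTuple]

theorem ι_conc_τ {n : ℕ} (x : Fin (n + 2) → A) :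
    T.conc (T.ι (x 0)) (T.τ n (Fin.tail x)) = T.τ (n + 1) x := by
  rw [ι, T.conc_eq]
  refine T.τ_congr (by omega) fun i => ?_
  simp only [appendTuple, Fin.tail]
  split_ifs with h
  · exact congrArg x (Fin.ext (Nat.le_zero.1 h).symm)
  · exact congrArg x (Fin.ext (Nat.sub_add_cancel (Nat.pos_of_ne_zero fun h' => h h'.le)))

theorem τ_conc_ι {n : ℕ} (x : Fin (n + 2) → A) :
    T.conc (T.τ n (Fin.init x)) (T.ι (x (Fin.last _))) = T.τ (n + 1) x := by
  rw [ι, T.conc_eq]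
  refine T.τ_congr (by omega) fun i => ?_
  simp only [appendTuple, Fin.init]
  split_ifs with h
  · rfl
  · exact congrArg x (Fin.ext (by simp only [Fin.val_last]; omega))

theorem headIns_conc {p : ℕ} (f : MultilinearMap k (fun _ : Fin (p + 1) => A) T.U)
    (v : Fin p → A) (x : A) (u : T.U) :
    T.headIns f v (T.conc (T.ι x) u) = T.conc (f (Fin.snoc v x)) u := by
  induction u using T.τ_induction with
  | add u v hu hv => simp [hu, hv]
  | smul c u hu => simp [hu]
  | τ n y =>
  have h := T.ι_conc_τ (Fin.cons x y : Fin (n + 2) → A)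
  have h' := T.headIns_eq f v (Fin.cons x y : Fin (n + 2) → A)
  simp only [Fin.cons_zero, Fin.tail_cons] at h h'
  rw [h, h']

theorem tailIns_conc {q : ℕ} (g : MultilinearMap k (fun _ : Fin (q + 1) => A) T.U)
    (v : Fin q → A) (x : A) (u : T.U) :
    T.tailIns g v (T.conc u (T.ι x)) = T.conc u (g (Fin.cons x v)) := by
  induction u using T.τ_induction with
  | add u v hu hv => simp [hu, hv]
  | smul c u hu => simp [hu]
  | τ n y =>
  have h := T.τ_conc_ι (Fin.snoc y x : Fin (n + 2) → A)
  have h' := T.tailIns_eq g v (Fin.snoc y x : Fin (n + 2) → A)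
  simp only [Fin.snoc_last, Fin.init_snoc] at h h'
  rw [h, h']

variable {T}

theorem conc_mem {a b : ℕ} {u v : T.U} (hu : u ∈ T.Tdeg (a + 1)) (hv : v ∈ T.Tdeg (b + 1)) :
    T.conc u v ∈ T.Tdeg (a + 1 + (b + 1)) := by
  rw [Tdeg_succ] at hu hv
  have h := Submodule.apply_mem_map₂ T.conc hu hv
  rw [Submodule.map₂_span_span] at h
  refine Submodule.span_le.2 ?_ h
  rintro _ ⟨_, ⟨x, rfl⟩, _, ⟨y, rfl⟩, rfl⟩
  simp only [T.conc_eq]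
  rw [show a + 1 + (b + 1) = a + b + 1 + 1 by omega]
  exact T.τ_mem _ _

/-- A property stable under linear combinations holds in degree at least two if it holds for
concatenations with an element of degree one on the left. -/
theorem head_induction {n : ℕ} {P : T.U → Prop}
    (conc : ∀ x, ∀ u ∈ T.Tdeg (n + 1), P (T.conc (T.ι x) u))
    (add : ∀ u v, P u → P v → P (u + v)) (smul : ∀ (c : k) u, P u → P (c • u))
    (u : T.U) (hu : u ∈ T.Tdeg (n + 2)) : P u := by
  rw [Tdeg_succ] at hu
  have hτ (x) : P (T.τ (n + 1) x) := T.ι_conc_τ x ▸ conc _ _ (T.τ_mem _ _)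
  induction hu using Submodule.span_induction with
  | mem u h => obtain ⟨x, rfl⟩ := h; exact hτ x
  | zero => simpa using smul 0 _ (hτ 0)
  | add u v _ _ hu hv => exact add u v hu hv
  | smul c u _ hu => exact smul c u hu

/-- A property stable under linear combinations holds in degree at least two if it holds for
concatenations with an element of degree one on the right. -/
theorem tail_induction {n : ℕ} {P : T.U → Prop}
    (conc : ∀ x, ∀ u ∈ T.Tdeg (n + 1), P (T.conc u (T.ι x)))
    (add : ∀ u v, P u → P v → P (u + v)) (smul : ∀ (c : k) u, P u → P (c • u))
    (u : T.U) (hu : u ∈ T.Tdeg (n + 2)) : P u := by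
  rw [Tdeg_succ] at hu
  have hτ (x) : P (T.τ (n + 1) x) := T.τ_conc_ι x ▸ conc _ _ (T.τ_mem _ _)
  induction hu using Submodule.span_induction with
  | mem u h => obtain ⟨x, rfl⟩ := h; exact hτ x
  | zero => simpa using smul 0 _ (hτ 0)
  | add u v _ _ hu hv => exact add u v hu hv
  | smul c u _ hu => exact smul c u hu

theorem hoch_apply {n : ℕ} (f : MultilinearMap k (fun _ : Fin (n + 1) => A) T.U)
    (a : Fin (n + 2) → A) :
    T.hoch f a = T.mrg (T.ι (a 0)) (f (Fin.tail a))
      + (∑ i ∈ Finset.range (n + 1), (-1 : ℤ) ^ (i + 1) • f (contract a i))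
      + (-1 : ℤ) ^ n • T.mrg (f (Fin.init a)) (T.ι (a (Fin.last _))) := by
  rw [T.hoch_eq, Finset.sum_range, pow_add _ n 2]
  simp only [neg_one_sq, mul_one]
  rfl

section Head

variable {p n : ℕ} (f : MultilinearMap k (fun _ : Fin (p + 1) => A) T.U)

theorem headIns_mem {d : ℕ} (hf : ∀ x, f x ∈ T.Tdeg (d + 1)) (v : Fin p → A) :
    ∀ u ∈ T.Tdeg (n + 2), T.headIns f v u ∈ T.Tdeg (d + 1 + (n + 1)) := by
  refine head_induction ?_ ?_ ?_
  · intro x u hu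
    rw [headIns_conc]
    exact conc_mem (hf _) hu
  · intro u v hu hv; simpa using add_mem hu hv
  · intro c u hu; simpa using Submodule.smul_mem _ c hu

theorem headIns_mrg (v : Fin p → A) (w : T.U) :
    ∀ u ∈ T.Tdeg (n + 2), T.headIns f v (T.mrg u w) = T.mrg (T.headIns f v u) w := by
  refine head_induction ?_ ?_ ?_
  · intro x u hu
    rw [headIns_conc, mrg_conc_left, mrg_conc_left, headIns_conc]
  · intro u v hu hv; simp [hu, hv]
  · intro c u hu; simp [hu]

/-- Insertion into the first tensor component, as a multilinear map in the explicit arguments. -/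
def headInsMultilinear (n : ℕ) :
    MultilinearMap k (fun _ : Fin p => A) (T.Tdeg (n + 2) →ₗ[k] T.U) :=
  MultilinearMap.mk' (fun v => (T.headIns f v).domRestrict _)
    (fun v i x y => by
    refine LinearMap.ext fun u => ?_
    refine head_induction (P := fun u => T.headIns f (Function.update v i (x + y)) u
      = T.headIns f (Function.update v i x) u + T.headIns f (Function.update v i y) u)
      ?_ ?_ ?_ u u.2
    · intro z u hu
      simp [headIns_conc, Fin.snoc_update]
    · intro u v hu hv
      simp only [map_add, hu, hv]
      abel
    · intro c u hu
      simp [hu])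
    (fun v i c x => by
    refine LinearMap.ext fun u => ?_
    refine head_induction (P := fun u => T.headIns f (Function.update v i (c • x)) u
      = c • T.headIns f (Function.update v i x) u) ?_ ?_ ?_ u u.2
    · intro z u hu
      simp [headIns_conc, Fin.snoc_update]
    · intro u v hu hv
      simp [hu, hv]
    · intro d u hu
      simp [hu, smul_comm c d])

/-- The cocycle identity for `f`, with a tensor inserted in its last argument. -/
theorem hoch_headIns (hf : T.hoch f = 0) (v : Fin (p + 1) → A) :
    ∀ u ∈ T.Tdeg (n + 2),
      T.mrg (T.ι (v 0)) (T.headIns f (Fin.tail v) u)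
        + (∑ i ∈ Finset.range p, (-1 : ℤ) ^ (i + 1) • T.headIns f (contract v i) u)
        + (-1 : ℤ) ^ (p + 1) • T.headIns f (Fin.init v) (T.mrg (T.ι (v (Fin.last p))) u)
        + (-1 : ℤ) ^ p • T.mrg (f v) u = 0 := by
  refine head_induction ?_ ?_ ?_
  · intro x u hu
    have h : T.conc.flip u (T.hoch f (Fin.snoc v x)) = 0 := by simp [hf]
    rw [hoch_apply, Finset.sum_range_succ, contract_snoc_last, tail_snoc, Fin.init_snoc,
      Fin.snoc_last, Finset.sum_congr rfl fun i hi => by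
        rw [contract_snoc v x (Finset.mem_range.1 hi)]] at h
    have h0 : (Fin.snoc v x : Fin (p + 2) → A) 0 = v 0 := Fin.snoc_castSucc (i := 0) ..
    simp only [mrg_conc, mrg_ι, headIns_conc]
    simpa only [h0, add_assoc, map_add, map_sum, map_zsmul, LinearMap.flip_apply] using h
  · intro u w hu hw
    rw [← add_zero (0 : T.U)]
    nth_rw 1 [← hu]
    rw [← hw]
    simp only [map_add, smul_add, Finset.sum_add_distrib]
    abel
  · intro c u hu
    rw [← smul_zero (A := T.U) c, ← hu]
    simp only [map_smul, smul_add, Finset.smul_sum, smul_comm c]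

end Head

section Tail

variable {q n : ℕ} (g : MultilinearMap k (fun _ : Fin (q + 1) => A) T.U)

theorem tailIns_mem {d : ℕ} (hg : ∀ x, g x ∈ T.Tdeg (d + 1)) (v : Fin q → A) :
    ∀ u ∈ T.Tdeg (n + 2), T.tailIns g v u ∈ T.Tdeg (n + 1 + (d + 1)) := by
  refine tail_induction ?_ ?_ ?_
  · intro x u hu
    rw [tailIns_conc]
    exact conc_mem hu (hg _)
  · intro u v hu hv; simpa using add_mem hu hv
  · intro c u hu; simpa using Submodule.smul_mem _ c hu

theorem tailIns_mrg (v : Fin q → A) (w : T.U) :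
    ∀ u ∈ T.Tdeg (n + 2), T.tailIns g v (T.mrg w u) = T.mrg w (T.tailIns g v u) := by
  refine tail_induction ?_ ?_ ?_
  · intro x u hu
    rw [tailIns_conc, mrg_conc, mrg_conc, tailIns_conc]
  · intro u v hu hv; simp [hu, hv]
  · intro c u hu; simp [hu]

/-- Insertion into the last tensor component, as a multilinear map in the explicit arguments. -/
def tailInsMultilinear (n : ℕ) :
    MultilinearMap k (fun _ : Fin q => A) (T.Tdeg (n + 2) →ₗ[k] T.U) :=
  MultilinearMap.mk' (fun v => (T.tailIns g v).domRestrict _)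
    (fun v i x y => by
    refine LinearMap.ext fun u => ?_
    refine tail_induction (P := fun u => T.tailIns g (Function.update v i (x + y)) u
      = T.tailIns g (Function.update v i x) u + T.tailIns g (Function.update v i y) u)
      ?_ ?_ ?_ u u.2
    · intro z u hu
      simp [tailIns_conc, Fin.cons_update]
    · intro u v hu hv
      simp only [map_add, hu, hv]
      abel
    · intro c u hu
      simp [hu])
    (fun v i c x => by
    refine LinearMap.ext fun u => ?_
    refine tail_induction (P := fun u => T.tailIns g (Function.update v i (c • x)) u
      = c • T.tailIns g (Function.update v i x) u) ?_ ?_ ?_ u u.2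
    · intro z u hu
      simp [tailIns_conc, Fin.cons_update]
    · intro u v hu hv
      simp [hu, hv]
    · intro d u hu
      simp [hu, smul_comm c d])

/-- The cocycle identity for `g`, with a tensor inserted in its first argument. -/
theorem hoch_tailIns (hg : T.hoch g = 0) (v : Fin (q + 1) → A) :
    ∀ u ∈ T.Tdeg (n + 2),
      T.mrg u (g v) - T.tailIns g (Fin.tail v) (T.mrg u (T.ι (v 0)))
        + (∑ i ∈ Finset.range q, (-1 : ℤ) ^ i • T.tailIns g (contract v i) u)
        + (-1 : ℤ) ^ q • T.mrg (T.tailIns g (Fin.init v) u) (T.ι (v (Fin.last q))) = 0 := by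
  refine tail_induction ?_ ?_ ?_
  · intro x u hu
    have h : T.conc u (T.hoch g (Fin.cons x v)) = 0 := by simp [hg]
    have h0 : (Fin.cons x v : Fin (q + 2) → A) (Fin.last _) = v (Fin.last q) :=
      Fin.cons_succ (i := Fin.last q) ..
    rw [hoch_apply, Finset.sum_range_succ', contract_cons_zero, Fin.tail_cons, init_cons,
      Fin.cons_zero, h0] at h
    simp only [contract_cons_succ] at h
    simp only [mrg_conc_left, mrg_ι, tailIns_conc]
    simp only [map_add, map_sum, map_zsmul, pow_succ, pow_zero, mul_neg, mul_one, map_neg,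
      neg_neg, neg_smul, one_smul] at h
    rw [← h]
    abel
  · intro u w hu hw
    rw [← add_zero (0 : T.U)]
    nth_rw 1 [← hu]
    rw [← hw]
    simp only [map_add, smul_add, Finset.sum_add_distrib, LinearMap.add_apply]
    abel
  · intro c u hu
    rw [← smul_zero (A := T.U) c, ← hu]
    simp only [map_smul, smul_add, smul_sub, Finset.smul_sum, smul_comm c, LinearMap.smul_apply]

end Tail

theorem hoch_zsmul {n : ℕ} (c : ℤ) (f : MultilinearMap k (fun _ : Fin (n + 1) => A) T.U) :
    T.hoch (c • f) = c • T.hoch f := by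
  ext a
  simp only [hoch_apply, _root_.smul_apply, map_zsmul, smul_add, Finset.smul_sum,
    smul_comm c, LinearMap.smul_apply]

/-- If `g` takes values in degree at least two, then `f ∪ g` is, up to sign, the coboundary of
`f ⊢ g`, which inserts the first tensor component of `g` into the last argument of `f`. -/
theorem hoch_eq_cup_of_head {p q n d : ℕ} {f : MultilinearMap k (fun _ : Fin (p + 1) => A) T.U}
    {g : MultilinearMap k (fun _ : Fin (q + 1) => A) T.U}
    (hf : ∀ x, f x ∈ T.Tdeg (d + 1)) (hg : ∀ x, g x ∈ T.Tdeg (n + 2))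
    (hfc : T.hoch f = 0) (hgc : T.hoch g = 0) :
    ∃ e : MultilinearMap k (fun _ : Fin (p + q + 1) => A) T.U,
      (∀ x, e x ∈ T.Tdeg (d + 1 + (n + 1))) ∧ T.hoch e = T.cup f g := by
  obtain ⟨e, he⟩ : ∃ e : MultilinearMap k (fun _ : Fin (p + q + 1) => A) T.U, ∀ a,
      e a = T.headIns f (firstEntries p (by omega) a) (g (entriesFrom p (q + 1) (by omega) a)) :=
    ⟨splitArgs (add_assoc p q 1).symm LinearMap.id (headInsMultilinear f n)
      (g.codRestrict _ hg), fun a => rfl⟩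
  refine ⟨(-1 : ℤ) ^ (p + 1) • e, fun x => ?_, ?_⟩
  · rw [_root_.smul_apply, he]
    exact zsmul_mem (headIns_mem f hf _ _ (hg _)) _
  rw [hoch_zsmul]
  ext a
  have h1 := hoch_headIns f hfc (firstEntries (p + 1) (by omega) a) _
    (hg (entriesFrom (p + 1) (q + 1) (by omega) a))
  have h2 : T.headIns f (firstEntries p (by omega) a)
      (T.hoch g (entriesFrom p (q + 2) (by omega) a)) = 0 := by simp [hgc]
  rw [hoch_apply] at h2
  simp only [map_add, map_sum, map_zsmul] at h2
  rw [headIns_mrg _ _ _ _ (hg _)] at h2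
  have h3 : ∑ i ∈ Finset.range (p + q + 1), (-1 : ℤ) ^ (i + 1) • e (contract a i)
      = (∑ i ∈ Finset.range p, (-1 : ℤ) ^ (i + 1) •
          T.headIns f (contract (firstEntries (p + 1) (by omega) a) i)
            (g (entriesFrom (p + 1) (q + 1) (by omega) a)))
        + (-1 : ℤ) ^ p • ∑ i ∈ Finset.range (q + 1), (-1 : ℤ) ^ (i + 1) •
          T.headIns f (firstEntries p (by omega) a)
            (g (contract (entriesFrom p (q + 2) (by omega) a) i)) := by
    rw [show Finset.range (p + q + 1) = Finset.range (p + (q + 1)) from rfl,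
      Finset.sum_range_add, Finset.smul_sum]
    congr 1
    · refine Finset.sum_congr rfl fun i hi => ?_
      rw [he, firstEntries_contract, entriesFrom_contract_of_lt _ _ _ (Finset.mem_range.1 hi)]
    · refine Finset.sum_congr rfl fun i hi => ?_
      rw [he, firstEntries_contract_of_le _ _ (Nat.le_add_right p i), entriesFrom_contract,
        smul_smul, ← pow_add, add_assoc]
  have e0 : T.mrg (T.ι (a 0)) (e (Fin.tail a)) = T.mrg (T.ι (firstEntries (p + 1) (by omega) a 0))
      (T.headIns f (Fin.tail (firstEntries (p + 1) (by omega) a))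
        (g (entriesFrom (p + 1) (q + 1) (by omega) a))) := by
    rw [he, firstEntries_tail, entriesFrom_tail]
    rfl
  have e1 : T.mrg (e (Fin.init a)) (T.ι (a (Fin.last _)))
      = T.mrg (T.headIns f (firstEntries p (by omega) a)
          (g (Fin.init (entriesFrom p (q + 2) (by omega) a))))
        (T.ι (entriesFrom p (q + 2) (by omega) a (Fin.last (q + 1)))) := by
    rw [he]
    rfl
  have e2 : T.mrg (T.ι (entriesFrom p (q + 2) (by omega) a 0))
      (g (Fin.tail (entriesFrom p (q + 2) (by omega) a)))
      = T.mrg (T.ι (firstEntries (p + 1) (by omega) a (Fin.last p)))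
        (g (entriesFrom (p + 1) (q + 1) (by omega) a)) := by
    rw [tail_entriesFrom]
    rfl
  have e3 : T.cup f g a = T.mrg (f (firstEntries (p + 1) (by omega) a))
      (g (entriesFrom (p + 1) (q + 1) (by omega) a)) := T.cup_eq f g a
  have e4 : Fin.init (firstEntries (p + 1) (by omega) a) = firstEntries p (by omega) a := rfl
  rw [_root_.smul_apply, hoch_apply, e0, h3, e1, e3]
  rw [e2] at h2
  rw [e4] at h1
  rcases neg_one_pow_eq_or ℤ p with hp | hp <;> simp only [pow_add _ p, hp] at h1 ⊢
  · linear_combination (norm := module) -h1 - h2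
  · linear_combination (norm := module) h1 - h2

/-- If `f` takes values in degree at least two, then `f ∪ g` is, up to sign, the coboundary of
`f ⊣ g`, which inserts the last tensor component of `f` into the first argument of `g`. -/
theorem hoch_eq_cup_of_tail {p q n d : ℕ} {f : MultilinearMap k (fun _ : Fin (p + 1) => A) T.U}
    {g : MultilinearMap k (fun _ : Fin (q + 1) => A) T.U}
    (hf : ∀ x, f x ∈ T.Tdeg (n + 2)) (hg : ∀ x, g x ∈ T.Tdeg (d + 1))
    (hfc : T.hoch f = 0) (hgc : T.hoch g = 0) :
    ∃ e : MultilinearMap k (fun _ : Fin (p + q + 1) => A) T.U,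
      (∀ x, e x ∈ T.Tdeg (n + 1 + (d + 1))) ∧ T.hoch e = T.cup f g := by
  obtain ⟨e, he⟩ : ∃ e : MultilinearMap k (fun _ : Fin (p + q + 1) => A) T.U, ∀ a,
      e a = T.tailIns g (entriesFrom (p + 1) q (by omega) a)
        (f (firstEntries (p + 1) (by omega) a)) :=
    ⟨splitArgs (add_right_comm p 1 q) LinearMap.id.flip (f.codRestrict _ hf)
      (tailInsMultilinear g n), fun a => rfl⟩
  refine ⟨(-1 : ℤ) ^ (p + 1) • e, fun x => ?_, ?_⟩
  · rw [_root_.smul_apply, he]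
    exact zsmul_mem (tailIns_mem g hg _ _ (hf _)) _
  rw [hoch_zsmul]
  ext a
  have h1 := hoch_tailIns g hgc (entriesFrom (p + 1) (q + 1) (by omega) a) _
    (hf (firstEntries (p + 1) (by omega) a))
  have h2 : T.tailIns g (entriesFrom (p + 2) q (by omega) a)
      (T.hoch f (firstEntries (p + 2) (by omega) a)) = 0 := by simp [hfc]
  rw [hoch_apply] at h2
  simp only [map_add, map_sum, map_zsmul] at h2
  rw [tailIns_mrg _ _ _ _ (hf _)] at h2
  have h3 : ∑ i ∈ Finset.range (p + q + 1), (-1 : ℤ) ^ (i + 1) • e (contract a i)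
      = (∑ i ∈ Finset.range (p + 1), (-1 : ℤ) ^ (i + 1) •
          T.tailIns g (entriesFrom (p + 2) q (by omega) a)
            (f (contract (firstEntries (p + 2) (by omega) a) i)))
        + (-1 : ℤ) ^ p • ∑ i ∈ Finset.range q, (-1 : ℤ) ^ i •
          T.tailIns g (contract (entriesFrom (p + 1) (q + 1) (by omega) a) i)
            (f (firstEntries (p + 1) (by omega) a)) := by
    rw [show Finset.range (p + q + 1) = Finset.range (p + 1 + q) by rw [add_right_comm],
      Finset.sum_range_add, Finset.smul_sum]
    congr 1
    · refine Finset.sum_congr rfl fun i hi => ?_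
      rw [he, firstEntries_contract, entriesFrom_contract_of_lt _ _ _ (Finset.mem_range.1 hi)]
    · refine Finset.sum_congr rfl fun i hi => ?_
      rw [he, firstEntries_contract_of_le _ _ (Nat.le_add_right (p + 1) i), entriesFrom_contract,
        smul_smul, ← pow_add, show p + 1 + i + 1 = p + i + 2 by omega, pow_add _ _ 2, neg_one_sq,
        mul_one]
  have e0 : T.mrg (T.ι (a 0)) (e (Fin.tail a)) = T.mrg (T.ι (firstEntries (p + 2) (by omega) a 0))
      (T.tailIns g (entriesFrom (p + 2) q (by omega) a)
        (f (Fin.tail (firstEntries (p + 2) (by omega) a)))) := by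
    rw [he, firstEntries_tail, entriesFrom_tail]
    rfl
  have e1 : T.mrg (e (Fin.init a)) (T.ι (a (Fin.last _)))
      = T.mrg (T.tailIns g (Fin.init (entriesFrom (p + 1) (q + 1) (by omega) a))
          (f (firstEntries (p + 1) (by omega) a)))
        (T.ι (entriesFrom (p + 1) (q + 1) (by omega) a (Fin.last q))) := by
    rw [he, show Fin.last (p + q + 1) = ⟨p + 1 + q, by omega⟩ by ext; simp; omega]
    rfl
  have e2 : Fin.tail (entriesFrom (p + 1) (q + 1) (by omega) a)
      = entriesFrom (p + 2) q (by omega) a := tail_entriesFrom ..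
  have e3 : T.cup f g a = T.mrg (f (firstEntries (p + 1) (by omega) a))
      (g (entriesFrom (p + 1) (q + 1) (by omega) a)) := T.cup_eq f g a
  have e4 : T.mrg (f (Fin.init (firstEntries (p + 2) (by omega) a)))
      (T.ι (firstEntries (p + 2) (by omega) a (Fin.last (p + 1))))
      = T.mrg (f (firstEntries (p + 1) (by omega) a))
        (T.ι (entriesFrom (p + 1) (q + 1) (by omega) a 0)) := rfl
  rw [_root_.smul_apply, hoch_apply, e0, h3, e1, e3]
  rw [e4] at h2
  rw [e2] at h1
  rcases neg_one_pow_eq_or ℤ p with hp | hp <;> simp only [pow_add _ p, hp] at h2 ⊢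
  · linear_combination (norm := module) -h1 - h2
  · linear_combination (norm := module) -h1 + h2

end TensorTower

/-- Let `p, q ≥ 1` and `k, m ≥ 1` with `k ≥ 2` or `m ≥ 2` (here
`p ↦ p+1`, `q ↦ q+1`).  If `f ∈ C^p(A, A^{⊗k})` and `g ∈ C^q(A, A^{⊗m})` are Hochschild
cocycles then the cup product `f∪g ∈ C^{p+q}(A, A^{⊗(k+m−1)})` is a Hochschild
coboundary; in other words, the cup product induces the zero map on Hochschild
cohomology whenever `k ≥ 2` or `m ≥ 2`. -/
theorem cup_product_zero_on_cohomology
    {k A : Type} [Field k] [CharZero k] [Ring A] [Algebra k A]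
    (T : TensorTower k A) (p q k1 m1 : ℕ)
    (hk1 : 1 ≤ k1) (hm1 : 1 ≤ m1) (hkm : 2 ≤ k1 ∨ 2 ≤ m1)
    (f : MultilinearMap k (fun _ : Fin (p + 1) => A) T.U)
    (g : MultilinearMap k (fun _ : Fin (q + 1) => A) T.U)
    (hf : ∀ x, f x ∈ T.Tdeg k1)
    (hg : ∀ x, g x ∈ T.Tdeg m1)
    (hfc : T.hoch f = 0)
    (hgc : T.hoch g = 0) :
    ∃ e : MultilinearMap k (fun _ : Fin (p + q + 1) => A) T.U,
      (∀ x, e x ∈ T.Tdeg (k1 + m1 - 1)) ∧ T.hoch e = T.cup f g := by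
  rcases hkm with h | h
  · obtain ⟨n, rfl⟩ := Nat.exists_eq_add_of_le' h
    obtain ⟨d, rfl⟩ := Nat.exists_eq_add_of_le' hm1
    have := TensorTower.hoch_eq_cup_of_tail hf hg hfc hgc
    rwa [show n + 1 + (d + 1) = n + 2 + (d + 1) - 1 by omega] at this
  · obtain ⟨n, rfl⟩ := Nat.exists_eq_add_of_le' h
    obtain ⟨d, rfl⟩ := Nat.exists_eq_add_of_le' hk1
    exact TensorTower.hoch_eq_cup_of_head hf hg hfc hgc
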